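/- arXiv:2510.04448 — 2 statements merged into one kernel-verified Lean document; each statement's English description precedes it below -/
import Mathlib

section
/- Let μ be a probability mass function on a countable type α, let T be a natural number, and for each t ∈ {1,…,T} let f_t, g_t : α → PMF β_t be kernels. Let F(x) denote the independent product distribution f_1(x) × ⋯ × f_T(x) on β_1 × ⋯ × β_T, and similarly G(x) for the g_t. Then SD(μ ⋉ F, μ ⋉ G) ≤ ∑_{t=1}^T ∑_x μ(x) · SD(f_t(x), g_t(x)). -/
open scoped BigOperators

/-- Statistical distance between two PMFs: `SD(P,Q) = (1/2) * ∑_y |P y - Q y|`. -/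
noncomputable def SD {β : Type*} (P Q : PMF β) : ℝ :=
  (1 / 2) * ∑' y, |(P y).toReal - (Q y).toReal|

/-- The joint PMF `μ ⋉ f` on `α × β`, with `(μ ⋉ f)(x,y) = μ x * f x y`. -/
noncomputable def joint {α β : Type*} (μ : PMF α) (f : α → PMF β) : PMF (α × β) :=
  μ.bind fun x => (f x).map fun y => (x, y)

/-- The independent product of finitely many PMFs, as a PMF on the dependent
function type `(t : Fin T) → β t`. -/
noncomputable def piPMF : {T : ℕ} → {β : Fin T → Type} →
    ((t : Fin T) → PMF (β t)) → PMF ((t : Fin T) → β t)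
  | 0, _, _ => PMF.pure finZeroElim
  | _ + 1, _, f =>
      (f 0).bind fun b =>
        (piPMF fun t => f t.succ).map fun v => Fin.cons b v

theorem aux_summable {β : Type*} (P : PMF β) : Summable fun y => (P y).toReal :=
  ENNReal.summable_toReal P.tsum_coe_ne_top

theorem aux_tsum {β : Type*} (P : PMF β) : ∑' y, (P y).toReal = 1 := by
  rw [← ENNReal.tsum_toReal_eq (fun y => P.apply_ne_top y), P.tsum_coe]; simp

theorem aux_sd_summable {β : Type*} (P Q : PMF β) :
    Summable fun y => |(P y).toReal - (Q y).toReal| :=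
  ((aux_summable P).sub (aux_summable Q)).abs

theorem aux_sd_nonneg {β : Type*} (P Q : PMF β) : 0 ≤ SD P Q :=
  mul_nonneg (by norm_num) (tsum_nonneg fun _ => abs_nonneg _)

theorem aux_sd_le_one {β : Type*} (P Q : PMF β) : SD P Q ≤ 1 := by
  have h : ∑' y, |(P y).toReal - (Q y).toReal| ≤ ∑' y, ((P y).toReal + (Q y).toReal) := by
    refine (aux_sd_summable P Q).tsum_le_tsum (fun y => ?_) ((aux_summable P).add (aux_summable Q))
    have h1 : 0 ≤ (P y).toReal := ENNReal.toReal_nonneg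
    have h2 : 0 ≤ (Q y).toReal := ENNReal.toReal_nonneg
    rw [abs_le]; constructor <;> linarith
  rw [(aux_summable P).tsum_add (aux_summable Q), aux_tsum, aux_tsum] at h
  unfold SD; linarith

theorem aux_avg_summable {α β : Type*} (μ : PMF α) (f g : α → PMF β) :
    Summable fun x => (μ x).toReal * SD (f x) (g x) :=
  (aux_summable μ).of_nonneg_of_le
    (fun x => mul_nonneg ENNReal.toReal_nonneg (aux_sd_nonneg _ _))
    (fun x => mul_le_of_le_one_right ENNReal.toReal_nonneg (aux_sd_le_one _ _))

theorem aux_joint_apply {α β : Type*} (μ : PMF α) (f : α → PMF β) (x : α) (y : β) :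
    joint μ f (x, y) = μ x * f x y := by
  classical
  unfold joint
  rw [PMF.bind_apply, tsum_eq_single x]
  · congr 1
    rw [PMF.map_apply, tsum_eq_single y]
    · simp
    · intro b hb; simp [hb.symm]
  · intro x' hx
    rw [PMF.map_apply]
    simp [hx.symm]

theorem aux_sd_joint {α β : Type*} (μ : PMF α) (f g : α → PMF β) :
    SD (joint μ f) (joint μ g) = ∑' x, (μ x).toReal * SD (f x) (g x) := by
  unfold SD
  rw [(aux_sd_summable (joint μ f) (joint μ g)).tsum_prod, ← tsum_mul_left]
  refine tsum_congr fun x => ?_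
  rw [mul_left_comm, ← tsum_mul_left (a := (μ x).toReal)]
  congr 1
  refine tsum_congr fun y => ?_
  rw [aux_joint_apply, aux_joint_apply, ENNReal.toReal_mul, ENNReal.toReal_mul, ← mul_sub,
    abs_mul, abs_of_nonneg ENNReal.toReal_nonneg]

theorem aux_pi_succ {T : ℕ} {β : Fin (T + 1) → Type} (f : (t : Fin (T + 1)) → PMF (β t))
    (b : β 0) (v : (t : Fin T) → β t.succ) :
    piPMF f (Fin.cons b v) = f 0 b * piPMF (fun t => f t.succ) v := by
  classical
  rw [piPMF, PMF.bind_apply, tsum_eq_single b]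
  · congr 1
    rw [PMF.map_apply, tsum_eq_single v]
    · simp
    · intro w hw
      simp [Fin.cons_inj, hw.symm]
  · intro b' hb
    rw [PMF.map_apply]
    simp [Fin.cons_inj, hb.symm]

theorem aux_sd_pi : ∀ {T : ℕ} {β : Fin T → Type} (f g : (t : Fin T) → PMF (β t)),
    SD (piPMF f) (piPMF g) ≤ ∑ t, SD (f t) (g t)
  | 0, _, f, g => by simp [SD, piPMF]
  | T + 1, β, f, g => by
    have ih := aux_sd_pi (fun t => f t.succ) (fun t => g t.succ)
    rw [Fin.sum_univ_succ]
    refine le_trans ?_ (add_le_add_right ih _)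
    set P := piPMF (fun t => f t.succ)
    set Q := piPMF (fun t => g t.succ)
    have e : SD (piPMF f) (piPMF g) = (1 / 2) * ∑' p : β 0 × ((t : Fin T) → β t.succ),
        |(f 0 p.1).toReal * (P p.2).toReal - (g 0 p.1).toReal * (Q p.2).toReal| := by
      unfold SD
      rw [← (Fin.consEquiv β).tsum_eq]
      congr 1
      refine tsum_congr fun p => ?_
      have h1 := aux_pi_succ f p.1 p.2
      have h2 := aux_pi_succ g p.1 p.2
      simp only [Fin.consEquiv, Equiv.coe_fn_mk]
      rw [h1, h2, ENNReal.toReal_mul, ENNReal.toReal_mul]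
    have s1 := (aux_sd_summable (f 0) (g 0)).mul_of_nonneg (aux_summable P)
      (fun _ => abs_nonneg _) (fun _ => ENNReal.toReal_nonneg)
    have s2 := (aux_summable (g 0)).mul_of_nonneg (aux_sd_summable P Q)
      (fun _ => ENNReal.toReal_nonneg) (fun _ => abs_nonneg _)
    have t1 := (aux_sd_summable (f 0) (g 0)).tsum_mul_tsum (aux_summable P) s1
    have t2 := (aux_summable (g 0)).tsum_mul_tsum (aux_sd_summable P Q) s2
    rw [aux_tsum] at t1 t2
    have key : ∀ p : β 0 × ((t : Fin T) → β t.succ),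
        |(f 0 p.1).toReal * (P p.2).toReal - (g 0 p.1).toReal * (Q p.2).toReal| ≤
        |(f 0 p.1).toReal - (g 0 p.1).toReal| * (P p.2).toReal +
          (g 0 p.1).toReal * |(P p.2).toReal - (Q p.2).toReal| := by
      intro p
      have hP : 0 ≤ (P p.2).toReal := ENNReal.toReal_nonneg
      have hg : 0 ≤ (g 0 p.1).toReal := ENNReal.toReal_nonneg
      calc _ = |((f 0 p.1).toReal - (g 0 p.1).toReal) * (P p.2).toReal +
          (g 0 p.1).toReal * ((P p.2).toReal - (Q p.2).toReal)| := by congr 1; ring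
        _ ≤ _ := abs_add_le _ _
        _ = _ := by rw [abs_mul, abs_mul, abs_of_nonneg hP, abs_of_nonneg hg]
    have s12 := s1.add s2
    have le := (s12.of_nonneg_of_le (fun _ => abs_nonneg _) key).tsum_le_tsum key s12
    rw [s1.tsum_add s2, ← t1, ← t2] at le
    rw [e]
    unfold SD
    linarith

theorem sd_joint_pi_le_sum_avg {α : Type*} [Countable α] {T : ℕ} {β : Fin T → Type}
    [∀ t, Countable (β t)]
    (μ : PMF α) (f g : (t : Fin T) → α → PMF (β t)) :
    SD (joint μ fun x => piPMF fun t => f t x)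
        (joint μ fun x => piPMF fun t => g t x) ≤
      ∑ t : Fin T, ∑' x, (μ x).toReal * SD (f t x) (g t x) := by
  rw [aux_sd_joint, ← Summable.tsum_finsetSum (fun t _ => aux_avg_summable μ (f t) (g t))]
  refine (aux_avg_summable μ _ _).tsum_le_tsum (fun x => ?_)
    (summable_sum fun t _ => aux_avg_summable μ (f t) (g t))
  rw [← Finset.mul_sum]
  exact mul_le_mul_of_nonneg_left (aux_sd_pi _ _) ENNReal.toReal_nonneg
end

section
/- Let ν_0 and ν_1 be probability mass functions on a countable type α, let f_0, f_1 : α → ℝ satisfy 0 ≤ f_b(x) ≤ 1 for all x and b ∈ {0,1}, and let ε_0, ε_1, δ ≥ 0 be reals such that ∑_x ν_b(x)·f_b(x) ≥ 1 − ε_b for each b ∈ {0,1} and SD(ν_0, ν_1) ≤ δ. Then for every real p ≥ 1, ∑_x ν_0(x)·f_0(x)·f_1(x) ≥ (1 − p·ε_0 − p·ε_1 − δ)·(1 − 1/p)². -/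
open scoped BigOperators

theorem both_accept_lower_bound {α : Type*} [Countable α]
    (ν₀ ν₁ : PMF α) (f₀ f₁ : α → ℝ)
    (hf₀ : ∀ x, 0 ≤ f₀ x ∧ f₀ x ≤ 1) (hf₁ : ∀ x, 0 ≤ f₁ x ∧ f₁ x ≤ 1)
    (ε₀ ε₁ δ : ℝ) (hε₀ : 0 ≤ ε₀) (hε₁ : 0 ≤ ε₁) (hδ : 0 ≤ δ)
    (hacc₀ : 1 - ε₀ ≤ ∑' x, (ν₀ x).toReal * f₀ x)
    (hacc₁ : 1 - ε₁ ≤ ∑' x, (ν₁ x).toReal * f₁ x)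
    (hSD : SD ν₀ ν₁ ≤ δ) :
    ∀ p : ℝ, 1 ≤ p →
      (1 - p * ε₀ - p * ε₁ - δ) * (1 - 1 / p) ^ 2 ≤
        ∑' x, (ν₀ x).toReal * f₀ x * f₁ x := by
  intro p hp
  have key : ∀ ν : PMF α, HasSum (fun x => (ν x).toReal) 1 := by
    intro ν
    have h := ENNReal.hasSum_toReal (f := fun x => ν x) (by rw [ν.tsum_coe]; simp)
    rw [← ENNReal.tsum_toReal_eq (fun x => ν.apply_ne_top x), ν.tsum_coe] at h
    simpa using h
  have h0 := key ν₀
  have h1 := key ν₁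
  have n0 : ∀ x, 0 ≤ (ν₀ x).toReal := fun x => ENNReal.toReal_nonneg
  have n1 : ∀ x, 0 ≤ (ν₁ x).toReal := fun x => ENNReal.toReal_nonneg
  have s0 : Summable fun x => (ν₀ x).toReal * f₀ x :=
    Summable.of_nonneg_of_le (fun x => mul_nonneg (n0 x) (hf₀ x).1)
      (fun x => mul_le_of_le_one_right (n0 x) (hf₀ x).2) h0.summable
  have s1 : Summable fun x => (ν₁ x).toReal * f₁ x :=
    Summable.of_nonneg_of_le (fun x => mul_nonneg (n1 x) (hf₁ x).1)
      (fun x => mul_le_of_le_one_right (n1 x) (hf₁ x).2) h1.summable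
  have s2 : Summable fun x => (ν₀ x).toReal * f₀ x * f₁ x :=
    Summable.of_nonneg_of_le
      (fun x => mul_nonneg (mul_nonneg (n0 x) (hf₀ x).1) (hf₁ x).1)
      (fun x => mul_le_of_le_one_right (mul_nonneg (n0 x) (hf₀ x).1) (hf₁ x).2) s0
  have sd : Summable fun x => |(ν₀ x).toReal - (ν₁ x).toReal| :=
    (h0.summable.sub h1.summable).abs
  have hL := (((s0.hasSum.sub h0).add s1.hasSum).sub ((h1.sub h0).mul_left (1 / 2))).sub
    (sd.hasSum.mul_left (1 / 2))
  have hle := hasSum_le (fun x => by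
    have a := n0 x
    have b := hf₀ x
    have c := hf₁ x
    have e1 : 0 ≤ (ν₀ x).toReal * ((1 - f₀ x) * (1 - f₁ x)) :=
      mul_nonneg a (mul_nonneg (by linarith) (by linarith))
    have e2 : ((ν₁ x).toReal - (ν₀ x).toReal) * (f₁ x - 1 / 2)
        ≤ 1 / 2 * |(ν₀ x).toReal - (ν₁ x).toReal| := by
      rcases abs_cases ((ν₀ x).toReal - (ν₁ x).toReal) with ⟨h, h'⟩ | ⟨h, h'⟩ <;> rw [h] <;>
        nlinarith
    show _ ≤ (ν₀ x).toReal * f₀ x * f₁ x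
    nlinarith) hL s2.hasSum
  unfold SD at hSD
  have hT : 0 ≤ ∑' x, (ν₀ x).toReal * f₀ x * f₁ x :=
    tsum_nonneg fun x => mul_nonneg (mul_nonneg (n0 x) (hf₀ x).1) (hf₁ x).1
  have hp0 : 0 < 1 / p := by positivity
  have hp1 : 1 / p ≤ 1 := by rw [div_le_one (by linarith)]; exact hp
  have q1 : (1 - 1 / p) ^ 2 ≤ 1 := by nlinarith
  have q0 : 0 ≤ (1 - 1 / p) ^ 2 := sq_nonneg _
  rcases le_total (1 - p * ε₀ - p * ε₁ - δ) 0 with hA | hA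
  · exact (mul_nonpos_of_nonpos_of_nonneg hA q0).trans hT
  · refine (mul_le_of_le_one_right hA q1).trans ?_
    nlinarith
end
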